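/- For all integers j ≥ 0 and n ≥ 0, the following five congruences hold: a_{7j+1}(7n+5) ≡ 0 (mod 7), a_{7j+3}(7n+2) ≡ 0 (mod 7), a_{7j+4}(7n+4) ≡ 0 (mod 7), a_{7j+5}(7n+6) ≡ 0 (mod 7), and a_{7j+7}(7n+3) ≡ 0 (mod 7). -/

import Mathlib

/-- The set of `k`-colored-odd partitions of `n`: multisets of pairs `(m, c)` with
`m` a positive integer and `c ∈ {1, …, k}`, such that `c = 1` whenever `m` is even,
and the parts `m` sum (with multiplicity) to `n`. -/
def coloredOddPartitions (k n : ℕ) : Set (Multiset (ℕ × ℕ)) :=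
  {s | (∀ p ∈ s, 0 < p.1 ∧ 1 ≤ p.2 ∧ p.2 ≤ k ∧ (Even p.1 → p.2 = 1)) ∧
    (s.map Prod.fst).sum = n}

/-- `a k n` is the number of `k`-colored-odd partitions of `n`. -/
noncomputable def a (k n : ℕ) : ℕ := Nat.card (coloredOddPartitions k n)

/-! ### The `q`-binomial coefficients and the finite triple product -/

section FiniteTriple

variable {A : Type*} [CommRing A]

/-- Gaussian binomial coefficients in a commutative ring. -/
def qb (Q : A) : ℕ → ℕ → A
  | _, 0 => 1
  | 0, _ + 1 => 0
  | n + 1, i + 1 => qb Q n i + Q ^ (i + 1) * qb Q n (i + 1)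

/-- Finite Pochhammer products. -/
def qp (Q : A) (n : ℕ) : A := ∏ k ∈ Finset.range n, (1 - Q ^ (k + 1))

theorem qb_zero (Q : A) (n : ℕ) : qb Q n 0 = 1 := by cases n <;> rfl

theorem qb_succ (Q : A) (n i : ℕ) :
    qb Q (n + 1) (i + 1) = qb Q n i + Q ^ (i + 1) * qb Q n (i + 1) := rfl

theorem qb_of_lt (Q : A) (n : ℕ) : ∀ i, n < i → qb Q n i = 0 := by
  induction n with
  | zero => intro i hi; obtain ⟨i, rfl⟩ := Nat.exists_eq_succ_of_ne_zero hi.ne'; rfl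
  | succ n ih =>
    intro i hi
    obtain ⟨i, rfl⟩ := Nat.exists_eq_succ_of_ne_zero (show i ≠ 0 by omega)
    rw [Nat.succ_eq_add_one, qb_succ, ih i (by omega), ih (i + 1) (by omega)]; ring

theorem qb_self (Q : A) (n : ℕ) : qb Q n n = 1 := by
  induction n with
  | zero => rfl
  | succ n ih => rw [qb_succ, ih, qb_of_lt Q n (n + 1) (by omega)]; ring

theorem qb_mul (Q : A) : ∀ i j : ℕ, qb Q (i + j) i * qp Q i * qp Q j = qp Q (i + j) := by
  intro i
  induction i with
  | zero => intro j; simp [qb_zero, qp]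
  | succ i ih =>
    intro j
    induction j with
    | zero => simp [qb_self, qp]
    | succ j jh =>
      have e : i + 1 + (j + 1) = (i + (j + 1)) + 1 := by ring
      have h1 := ih (j + 1)
      have e2 : i + 1 + j = i + (j + 1) := by ring
      rw [e2] at jh
      rw [e, qb_succ]
      have p : ∀ n, qp Q (n + 1) = qp Q n * (1 - Q ^ (n + 1)) := fun n => by
        simp [qp, Finset.prod_range_succ]
      rw [p (i + (j + 1)), p i]
      rw [p i] at jh
      have := p j
      linear_combination (1 - Q ^ (i + 1)) * h1 + Q ^ (i + 1) * (1 - Q ^ (j + 1)) * jh +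
        (Q ^ (i + 1) * qb Q (i + (j + 1)) (i + 1) * (qp Q i * (1 - Q ^ (i + 1)))) * this

theorem qb_sum1 (Q : A) (M : ℕ) (g : ℕ → A) :
    ∑ i ∈ Finset.range (M + 2), qb Q (M + 1) i * g i =
      ∑ i ∈ Finset.range (M + 1), qb Q M i * (g (i + 1) + Q ^ i * g i) := by
  rw [Finset.sum_range_succ']
  simp only [qb_succ, qb_zero]
  have h : ∑ i ∈ Finset.range (M + 1), qb Q M i * (Q ^ i * g i) =
      ∑ i ∈ Finset.range (M + 1), qb Q M (i + 1) * (Q ^ (i + 1) * g (i + 1)) + g 0 := by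
    have h1 : ∑ i ∈ Finset.range (M + 2), qb Q M i * (Q ^ i * g i) =
        ∑ i ∈ Finset.range (M + 1), qb Q M i * (Q ^ i * g i) := by
      rw [Finset.sum_range_succ, qb_of_lt Q M (M + 1) (by omega)]; ring
    rw [← h1, Finset.sum_range_succ', qb_zero]
    simp
  simp only [mul_add, Finset.sum_add_distrib]
  rw [h]
  simp only [add_mul, Finset.sum_add_distrib]
  rw [add_assoc, one_mul]
  congr 2
  exact Finset.sum_congr rfl fun i _ => by ring

theorem qb_sum2 (Q : A) (M : ℕ) : ∀ (g : ℕ → A),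
    ∑ i ∈ Finset.range (M + 2), qb Q (M + 1) i * g i =
      ∑ i ∈ Finset.range (M + 1), qb Q M i * (g i + Q ^ (M - i) * g (i + 1)) := by
  induction M with
  | zero => intro g; simp [Finset.sum_range_succ, qb]
  | succ M ih =>
    intro g
    rw [qb_sum1, ih, qb_sum1]
    refine Finset.sum_congr rfl fun i hi => ?_
    have hi' : i ≤ M := by simpa [Nat.lt_succ_iff] using hi
    obtain ⟨j, rfl⟩ := Nat.exists_eq_add_of_le hi'
    have e1 : i + j - i = j := by omega
    have e2 : i + j + 1 - i = j + 1 := by omega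
    have e3 : i + j + 1 - (i + 1) = j := by omega
    rw [e1, e2, e3]
    ring

/-- Triangular numbers with integer index. -/
def tri (k : ℤ) : ℕ := (k * (k + 1) / 2).toNat

theorem tri_spec (k : ℤ) : 2 * (tri k : ℤ) = k * (k + 1) := by
  have h0 : 0 ≤ k * (k + 1) := by
    rcases le_or_gt 0 k with h | h
    · positivity
    · nlinarith
  have h2 : (2 : ℤ) ∣ k * (k + 1) := (Int.even_mul_succ_self k).two_dvd
  unfold tri
  omega

theorem tri_ge (k : ℤ) : k.natAbs ≤ tri k + 1 := by
  have h := tri_spec k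
  zify
  rcases abs_cases k with ⟨h1, h2⟩ | ⟨h1, h2⟩ <;> rw [h1] <;> nlinarith [sq_nonneg (k + 1), sq_nonneg k, sq_nonneg (k+2)]

theorem finite_triple (a b : A) (m n : ℕ) :
    (∏ k ∈ Finset.range m, (1 + a * (a * b) ^ k)) * (∏ k ∈ Finset.range n, (1 + b * (a * b) ^ k)) =
      ∑ i ∈ Finset.range (m + n + 1), qb (a * b) (m + n) i *
        (a ^ tri ((i : ℤ) - n) * b ^ tri ((i : ℤ) - n - 1)) := by
  induction n with
  | zero =>
    induction m with
    | zero => simp [qb, tri]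
    | succ m ih =>
      rw [Finset.prod_range_succ, mul_right_comm, ih, Nat.add_zero, Nat.add_zero, qb_sum2,
        Finset.sum_mul]
      refine Finset.sum_congr rfl fun i hi => ?_
      have hi' : i ≤ m := by simpa [Nat.lt_succ_iff] using hi
      obtain ⟨j, rfl⟩ := Nat.exists_eq_add_of_le hi'
      have e1 : i + j - i = j := by omega
      have t0 := tri_spec ((i : ℤ) - (0 : ℕ))
      have t1 := tri_spec ((i : ℤ) - (0 : ℕ) - 1)
      have t2 := tri_spec (((i + 1 : ℕ) : ℤ) - (0 : ℕ))
      have t3 := tri_spec (((i + 1 : ℕ) : ℤ) - (0 : ℕ) - 1)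
      have h1 : tri (((i + 1 : ℕ) : ℤ) - (0 : ℕ)) + j = tri ((i : ℤ) - (0 : ℕ)) + (i + j) + 1 := by
        zify; push_cast at *; linarith
      have h2 : tri (((i + 1 : ℕ) : ℤ) - (0 : ℕ) - 1) + j = tri ((i : ℤ) - (0 : ℕ) - 1) + (i + j) := by
        zify; push_cast at *; linarith
      rw [e1]
      have h3 := congrArg (fun e => a ^ e) h1
      have h4 := congrArg (fun e => b ^ e) h2
      simp only [pow_add, pow_one] at h3 h4
      set U := a ^ tri ((i : ℤ) - (0 : ℕ))
      set V := b ^ tri ((i : ℤ) - (0 : ℕ) - 1)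
      set U' := a ^ tri (((i + 1 : ℕ) : ℤ) - (0 : ℕ))
      set V' := b ^ tri (((i + 1 : ℕ) : ℤ) - (0 : ℕ) - 1)
      rw [mul_pow, mul_pow, pow_add, pow_add]
      linear_combination (-qb (a * b) (i + j) i) * (V' * b ^ j * h3 + (U * (a ^ i * a ^ j) * a) * h4)
  | succ n ih =>
    rw [Finset.prod_range_succ, ← mul_assoc, ih, ← Nat.add_assoc, qb_sum1, Finset.sum_mul]
    refine Finset.sum_congr rfl fun i hi => ?_
    have t0 := tri_spec ((i : ℤ) - (n : ℕ))
    have t1 := tri_spec ((i : ℤ) - (n : ℕ) - 1)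
    have t2 := tri_spec ((i : ℤ) - ((n + 1 : ℕ) : ℤ))
    have t3 := tri_spec ((i : ℤ) - ((n + 1 : ℕ) : ℤ) - 1)
    have e1 : ((i + 1 : ℕ) : ℤ) - ((n + 1 : ℕ) : ℤ) = (i : ℤ) - (n : ℕ) := by push_cast; ring
    rw [e1]
    have h1 : tri ((i : ℤ) - ((n + 1 : ℕ) : ℤ)) + i = tri ((i : ℤ) - (n : ℕ)) + n := by
      zify; push_cast at *; linarith
    have h2 : tri ((i : ℤ) - ((n + 1 : ℕ) : ℤ) - 1) + i = tri ((i : ℤ) - (n : ℕ) - 1) + n + 1 := by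
      zify; push_cast at *; linarith
    have h3 := congrArg (fun e => a ^ e) h1
    have h4 := congrArg (fun e => b ^ e) h2
    simp only [pow_add, pow_one] at h3 h4
    set U := a ^ tri ((i : ℤ) - (n : ℕ))
    set V := b ^ tri ((i : ℤ) - (n : ℕ) - 1)
    set U' := a ^ tri ((i : ℤ) - ((n + 1 : ℕ) : ℤ))
    set V' := b ^ tri ((i : ℤ) - ((n + 1 : ℕ) : ℤ) - 1)
    rw [mul_pow, mul_pow]
    linear_combination (-qb (a * b) (m + n) i) * (V' * b ^ i * h3 + (U * a ^ n) * h4)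

theorem qb_map {B : Type*} [CommRing B] (φ : A →+* B) (Q : A) : ∀ n i,
    φ (qb Q n i) = qb (φ Q) n i := by
  intro n
  induction n with
  | zero => intro i; cases i <;> simp [qb]
  | succ n ih => intro i; cases i <;> simp [qb, ih]

end FiniteTriple

/-! ### Infinite products over `ZMod 7` -/

open PowerSeries PowerSeries.WithPiTopology Filter Topology

/-- The coefficient field. -/
abbrev K7 : Type := ZMod 7

instance fact7 : Fact (Nat.Prime 7) := ⟨by norm_num⟩

/-- Eventually constant coefficients. -/
theorem tendsto_iff_ev (p : ℕ → K7⟦X⟧) (L : K7⟦X⟧) :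
    Tendsto p atTop (𝓝 L) ↔ ∀ n, ∀ᶠ N in atTop, coeff n (p N) = coeff n L := by
  rw [tendsto_iff_coeff_tendsto]
  refine forall_congr' fun n => ?_
  rw [nhds_discrete, tendsto_pure]

/-- `gp α s d` is the infinite product of `1 + α q^(s + d k)`. -/
noncomputable def gp (α : K7) (s d : ℕ) : K7⟦X⟧ := ∏' k : ℕ, (1 + C α * X ^ (s + d * k))

/-- Partial products. -/
noncomputable def gpp (α : K7) (s d N : ℕ) : K7⟦X⟧ :=
  ∏ k ∈ Finset.range N, (1 + C α * X ^ (s + d * k))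

theorem tendsto_gpp (α : K7) (s d : ℕ) (hd : 0 < d) :
    Tendsto (gpp α s d) atTop (𝓝 (gp α s d)) := by
  have hm : Multipliable fun k : ℕ => (1 + C α * X ^ (s + d * k) : K7⟦X⟧) := by
    apply multipliable_one_add_of_tendsto_order_atTop_nhds_top
    refine ENat.tendsto_nhds_top_iff_natCast_lt.mpr fun n ↦ eventually_atTop.mpr ⟨n + 1, ?_⟩
    intro m hm
    grw [← le_order_mul, order_X_pow]
    have : n < s + d * m := by nlinarith
    have h2 : (n : ℕ∞) < ((s + d * m : ℕ) : ℕ∞) := by exact_mod_cast this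
    exact lt_of_lt_of_le h2 le_add_self
  exact hm.hasProd.tendsto_prod_nat

theorem gp_eq_of_tendsto {α : K7} {s d : ℕ} (hd : 0 < d) {L : K7⟦X⟧}
    (h : Tendsto (gpp α s d) atTop (𝓝 L)) : gp α s d = L :=
  tendsto_nhds_unique (tendsto_gpp α s d hd) h

theorem gp_split2 (α : K7) (s d : ℕ) (hd : 0 < d) :
    gp α s d = gp α s (2 * d) * gp α (s + d) (2 * d) := by
  have h1 := (tendsto_gpp α s d hd).comp (tendsto_id.const_mul_atTop' (show 0 < 2 by norm_num))
  have h2 := (tendsto_gpp α s (2 * d) (by omega)).mul (tendsto_gpp α (s + d) (2 * d) (by omega))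
  refine tendsto_nhds_unique h1 (h2.congr fun N => ?_)
  simp only [Function.comp, id]
  induction N with
  | zero => simp [gpp]
  | succ N ih =>
    unfold gpp at *
    rw [Finset.prod_range_succ, Finset.prod_range_succ, show 2 * (N + 1) = 2 * N + 1 + 1 by ring,
      Finset.prod_range_succ, Finset.prod_range_succ, ← ih]
    ring

theorem gp_split3 (α : K7) (s d : ℕ) (hd : 0 < d) :
    gp α s d = gp α s (3 * d) * gp α (s + d) (3 * d) * gp α (s + 2 * d) (3 * d) := by
  have h1 := (tendsto_gpp α s d hd).comp (tendsto_id.const_mul_atTop' (show 0 < 3 by norm_num))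
  have h2 := ((tendsto_gpp α s (3 * d) (by omega)).mul
    (tendsto_gpp α (s + d) (3 * d) (by omega))).mul (tendsto_gpp α (s + 2 * d) (3 * d) (by omega))
  refine tendsto_nhds_unique h1 (h2.congr fun N => ?_)
  simp only [Function.comp, id]
  induction N with
  | zero => simp [gpp]
  | succ N ih =>
    unfold gpp at *
    rw [Finset.prod_range_succ, Finset.prod_range_succ, Finset.prod_range_succ,
      show 3 * (N + 1) = 3 * N + 1 + 1 + 1 by ring,
      Finset.prod_range_succ, Finset.prod_range_succ, Finset.prod_range_succ, ← ih]
    ring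

theorem gp_shift (α : K7) (s d : ℕ) (hd : 0 < d) :
    gp α s d = (1 + C α * X ^ s) * gp α (s + d) d := by
  have h1 := (tendsto_gpp α s d hd).comp (tendsto_add_atTop_nat 1)
  have h2 := (tendsto_gpp α (s + d) d hd).const_mul (1 + C α * X ^ s)
  refine tendsto_nhds_unique h1 (h2.congr fun N => ?_)
  simp only [Function.comp]
  unfold gpp
  rw [Finset.prod_range_succ', mul_comm]
  simp only [mul_zero, add_zero]
  congr 1
  exact Finset.prod_congr rfl fun k _ => by ring

theorem gp_pm (s d : ℕ) (hd : 0 < d) :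
    gp 1 s d * gp (-1) s d = gp (-1) (2 * s) (2 * d) := by
  have h1 := (tendsto_gpp 1 s d hd).mul (tendsto_gpp (-1) s d hd)
  refine (gp_eq_of_tendsto (by omega) (h1.congr fun N => ?_)).symm
  unfold gpp
  rw [← Finset.prod_mul_distrib]
  refine Finset.prod_congr rfl fun k _ => ?_
  simp only [map_neg, map_one]
  ring

/-- `ff d` is the infinite product of `1 - q^(d k)`, `k ≥ 1`. -/
noncomputable def ff (d : ℕ) : K7⟦X⟧ := gp (-1) d d

theorem qp_eq (d N : ℕ) : qp (X ^ d : K7⟦X⟧) N = gpp (-1) d d N := by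
  unfold qp gpp
  refine Finset.prod_congr rfl fun k _ => ?_
  simp only [map_neg, map_one]
  ring

theorem gpp_dvd (α : K7) (s d N M : ℕ) (hN : N ≤ M) :
    (X : K7⟦X⟧) ^ (s + d * N) ∣ gpp α s d M - gpp α s d N := by
  induction M, hN using Nat.le_induction with
  | base => simp
  | succ M h ih =>
    have : gpp α s d (M + 1) - gpp α s d N =
        (gpp α s d M - gpp α s d N) + X ^ (s + d * M) * (gpp α s d M * C α) := by
      unfold gpp; rw [Finset.prod_range_succ]; ring
    rw [this]
    refine dvd_add ih (Dvd.dvd.mul_right (pow_dvd_pow _ ?_) _)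
    have := Nat.mul_le_mul_left d h
    omega

theorem gp_dvd (α : K7) (s d N : ℕ) (hd : 0 < d) :
    (X : K7⟦X⟧) ^ (s + d * N) ∣ gp α s d - gpp α s d N := by
  rw [X_pow_dvd_iff]
  intro m hm
  have h := (tendsto_iff_ev _ _).1 (tendsto_gpp α s d hd) m
  obtain ⟨M, hM, hM'⟩ := (h.and (eventually_ge_atTop N)).exists
  have := X_pow_dvd_iff.1 (gpp_dvd α s d N M hM') m hm
  rw [map_sub, ← hM, ← map_sub, this]

theorem constantCoeff_ff (d : ℕ) (hd : 0 < d) : constantCoeff (ff d) = 1 := by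
  have h := gp_dvd (-1) d d 0 hd
  have := X_pow_dvd_iff.1 h 0 (by omega)
  rw [map_sub, sub_eq_zero] at this
  rw [← coeff_zero_eq_constantCoeff_apply]
  unfold ff
  rw [this]
  simp [gpp]

theorem ff_ne_zero (d : ℕ) (hd : 0 < d) : ff d ≠ 0 := by
  intro h
  have := constantCoeff_ff d hd
  rw [h] at this
  simp at this

theorem isUnit_ff (d : ℕ) (hd : 0 < d) : IsUnit (ff d) := by
  rw [isUnit_iff_constantCoeff, constantCoeff_ff d hd]; exact isUnit_one

/-- The central `q`-binomial coefficients tend to `1 / ff d`. -/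
theorem ff_mul_qb (d i j D : ℕ) (hd : 0 < d) (hi : D ≤ i + 1) (hj : D ≤ j + 1) :
    (X : K7⟦X⟧) ^ D ∣ ff d * qb (X ^ d) (i + j) i - 1 := by
  have key : ∀ n, D ≤ n + 1 → (X : K7⟦X⟧) ^ D ∣ ff d - qp (X ^ d) n := by
    intro n hn
    rw [qp_eq]
    refine (pow_dvd_pow _ ?_).trans (gp_dvd (-1) d d n hd)
    nlinarith
  have h := qb_mul (X ^ d : K7⟦X⟧) i j
  obtain ⟨u, hu⟩ := key i hi
  obtain ⟨v, hv⟩ := key j hj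
  obtain ⟨w, hw⟩ := key (i + j) (by omega)
  have h2 : (X : K7⟦X⟧) ^ D ∣ (ff d * qb (X ^ d) (i + j) i - 1) * ff d := by
    refine ⟨qb (X ^ d) (i + j) i * (u * ff d + v * qp (X ^ d) i) - w, ?_⟩
    linear_combination h + qb (X ^ d) (i + j) i * (ff d * hu + qp (X ^ d) i * hv) - hw
  exact ((isUnit_ff d hd).dvd_mul_right).1 h2

/-- Properness of an exponent function. -/
def Proper {ι : Type*} (e : ι → ℕ) : Prop := ∀ n, {i | e i ≤ n}.Finite

theorem proper_of_ge {e : ℤ → ℕ} (h : ∀ k, k.natAbs ≤ e k + 1) : Proper e := by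
  intro n
  refine (Set.finite_Icc (-(n + 1 : ℤ)) (n + 1)).subset fun k hk => ?_
  have := h k
  simp only [Set.mem_ofPred_eq] at hk
  simp only [Set.mem_Icc]
  omega

theorem Proper.summable {ι : Type*} {e : ι → ℕ} (h : Proper e) (u : ι → K7) :
    Summable fun i => (monomial (e i) (u i) : K7⟦X⟧) := by
  rw [summable_iff_summable_coeff]
  intro n
  refine summable_of_hasFiniteSupport ((h n).subset fun i hi => ?_)
  simp only [Function.mem_support, coeff_monomial] at hi
  simp only [Set.mem_ofPred_eq]
  by_contra hc
  exact hi (if_neg (by omega))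

theorem Proper.prod {ι κ : Type*} {e : ι → ℕ} {e' : κ → ℕ} (h : Proper e) (h' : Proper e') :
    Proper fun p : ι × κ => e p.1 + e' p.2 := by
  intro n
  refine ((h n).prod (h' n)).subset fun p hp => ?_
  simp only [Set.mem_ofPred_eq] at hp
  simp only [Set.mem_prod, Set.mem_ofPred_eq]
  omega

theorem Proper.hasSum_mul {ι κ : Type*} {e : ι → ℕ} {e' : κ → ℕ} (h : Proper e) (h' : Proper e')
    {u : ι → K7} {v : κ → K7} {F G : K7⟦X⟧}
    (hF : HasSum (fun i => (monomial (e i) (u i) : K7⟦X⟧)) F)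
    (hG : HasSum (fun i => (monomial (e' i) (v i) : K7⟦X⟧)) G) :
    HasSum (fun p : ι × κ => (monomial (e p.1 + e' p.2) (u p.1 * v p.2) : K7⟦X⟧)) (F * G) := by
  have := hF.mul hG (by
    refine ((h.prod h').summable fun p => u p.1 * v p.2).congr fun p => ?_
    rw [monomial_mul_monomial])
  simp only [monomial_mul_monomial] at this
  exact this

/-- The passage to the limit in finite triple products. -/
theorem hasSum_of_finite (d : ℕ) (hd : 0 < d) (e : ℤ → ℕ) (he : ∀ k, k.natAbs ≤ e k + 1)
    (u : ℤ → K7) (p : ℕ → K7⟦X⟧) (L : K7⟦X⟧) (hp : Tendsto p atTop (𝓝 L))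
    (h : ∀ N, p N = ∑ i ∈ Finset.range (N + N + 1), qb (X ^ d) (N + N) i *
      monomial (e ((i : ℤ) - N)) (u ((i : ℤ) - N))) :
    HasSum (fun k : ℤ => (monomial (e k) (u k) : K7⟦X⟧)) (L * ff d) := by
  rw [hasSum_iff_hasSum_coeff]
  intro n
  have h1 := (tendsto_iff_ev _ _).1 (hp.mul_const (ff d)) n
  obtain ⟨N, hN, hN'⟩ := (h1.and (eventually_ge_atTop (n + 2))).exists
  rw [← hN, h N, Finset.sum_mul, map_sum]
  have h2 : ∀ i ∈ Finset.range (N + N + 1), coeff n (qb (X ^ d : K7⟦X⟧) (N + N) i *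
      monomial (e ((i : ℤ) - N)) (u ((i : ℤ) - N)) * ff d) =
      coeff n (monomial (e ((i : ℤ) - N)) (u ((i : ℤ) - N)) : K7⟦X⟧) := by
    intro i hi
    rw [← sub_eq_zero, ← map_sub]
    have hi' : i ≤ N + N := by simpa [Nat.lt_succ_iff] using hi
    obtain ⟨j, hj⟩ := Nat.exists_eq_add_of_le hi'
    have hk := he ((i : ℤ) - N)
    obtain ⟨w, hw⟩ := ff_mul_qb d i j (min i j + 1) hd (by omega) (by omega)
    have : (X : K7⟦X⟧) ^ (n + 1) ∣ qb (X ^ d : K7⟦X⟧) (N + N) i *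
      monomial (e ((i : ℤ) - N)) (u ((i : ℤ) - N)) * ff d -
        monomial (e ((i : ℤ) - N)) (u ((i : ℤ) - N)) := by
      rw [hj]
      have e1 : (monomial (e ((i : ℤ) - N)) (u ((i : ℤ) - N)) : K7⟦X⟧) =
          C (u ((i : ℤ) - N)) * X ^ (e ((i : ℤ) - N)) := monomial_eq_C_mul_X_pow _ _
      have : qb (X ^ d : K7⟦X⟧) (i + j) i *
        monomial (e ((i : ℤ) - N)) (u ((i : ℤ) - N)) * ff d -
        monomial (e ((i : ℤ) - N)) (u ((i : ℤ) - N)) =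
        X ^ (e ((i : ℤ) - N) + (min i j + 1)) * (w * C (u ((i : ℤ) - N))) := by
        rw [e1, pow_add]
        linear_combination C (u ((i : ℤ) - N)) * X ^ (e ((i : ℤ) - N)) * hw
      rw [this]
      exact Dvd.dvd.mul_right (pow_dvd_pow _ (by omega)) _
    exact X_pow_dvd_iff.1 this n (by omega)
  rw [Finset.sum_congr rfl h2]
  have h3 : ∑ i ∈ Finset.range (N + N + 1),
      coeff n (monomial (e ((i : ℤ) - N)) (u ((i : ℤ) - N)) : K7⟦X⟧) =
      ∑ k ∈ (Finset.range (N + N + 1)).image (fun i : ℕ => (i : ℤ) - N),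
        coeff n (monomial (e k) (u k) : K7⟦X⟧) := by
    rw [Finset.sum_image]
    intro x _ y _ hxy
    simp only at hxy
    omega
  rw [h3]
  refine hasSum_sum_of_ne_finset_zero fun k hk => ?_
  rw [coeff_monomial, if_neg]
  intro hc
  apply hk
  rw [Finset.mem_image]
  have := he k
  exact ⟨(k + N).toNat, by rw [Finset.mem_range]; omega, by omega⟩

/-! ### Classical theta series -/

theorem tri_sign (k : ℤ) : (-1 : K7) ^ tri k * (-1) ^ tri (k - 1) = (-1) ^ k := by
  rw [← pow_add]
  have h1 := tri_spec k
  have h2 := tri_spec (k - 1)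
  rcases Int.even_or_odd k with hk | hk
  · rw [hk.neg_one_zpow]
    obtain ⟨m, rfl⟩ := hk
    apply Even.neg_one_pow
    have : ((tri (m + m) + tri (m + m - 1) : ℕ) : ℤ) = 2 * (2 * m ^ 2) := by push_cast; linarith
    have h3 : Even ((tri (m + m) + tri (m + m - 1) : ℕ) : ℤ) := by rw [this]; exact even_two_mul _
    exact_mod_cast h3
  · rw [hk.neg_one_zpow]
    obtain ⟨m, rfl⟩ := hk
    apply Odd.neg_one_pow
    have : ((tri (2 * m + 1) + tri (2 * m + 1 - 1) : ℕ) : ℤ) = 2 * (2 * m ^ 2 + 2 * m) + 1 := by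
      push_cast; linarith
    have h3 : Odd ((tri (2 * m + 1) + tri (2 * m + 1 - 1) : ℕ) : ℤ) := by
      rw [this]; exact odd_two_mul_add_one _
    exact_mod_cast h3

theorem tri_exp_ge (s t : ℕ) (hs : 0 < s) (k : ℤ) : k.natAbs ≤ s * tri k + t * tri (k - 1) + 1 := by
  have := tri_ge k
  nlinarith [Nat.zero_le (t * tri (k - 1)), Nat.mul_le_mul_right (tri k) hs]

theorem proper_tri (s t : ℕ) (hs : 0 < s) : Proper fun k : ℤ => s * tri k + t * tri (k - 1) :=
  proper_of_ge (tri_exp_ge s t hs)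

theorem triple (α : K7) (hα : α * α = 1) (s t : ℕ) (hs : 0 < s) :
    HasSum (fun k : ℤ => (monomial (s * tri k + t * tri (k - 1))
      (α ^ tri k * α ^ tri (k - 1)) : K7⟦X⟧)) (gp α s (s + t) * gp α t (s + t) * ff (s + t)) := by
  refine hasSum_of_finite (s + t) (by omega) _ (tri_exp_ge s t hs) _
    (fun N => gpp α s (s + t) N * gpp α t (s + t) N) _
    ((tendsto_gpp _ _ _ (by omega)).mul (tendsto_gpp _ _ _ (by omega))) fun N => ?_
  have h := finite_triple (C α * X ^ s : K7⟦X⟧) (C α * X ^ t) N N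
  have hQ : (C α * X ^ s : K7⟦X⟧) * (C α * X ^ t) = X ^ (s + t) := by
    have : (C α * C α : K7⟦X⟧) = 1 := by rw [← map_mul, hα, map_one]
    rw [pow_add]; linear_combination X ^ s * X ^ t * this
  rw [hQ] at h
  have e1 : ∀ r, gpp α r (s + t) N =
      ∏ k ∈ Finset.range N, (1 + C α * X ^ r * (X ^ (s + t)) ^ k) := by
    intro r
    unfold gpp
    refine Finset.prod_congr rfl fun k _ => ?_
    rw [← pow_mul, mul_assoc, ← pow_add]
  rw [e1, e1, h]
  refine Finset.sum_congr rfl fun i _ => ?_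
  rw [monomial_eq_C_mul_X_pow, mul_pow, mul_pow, ← pow_mul, ← pow_mul, pow_add, map_mul, map_pow,
    map_pow]
  ring

theorem triple_neg (s t : ℕ) (hs : 0 < s) :
    HasSum (fun k : ℤ => (monomial (s * tri k + t * tri (k - 1)) ((-1) ^ k) : K7⟦X⟧))
      (gp (-1) s (s + t) * gp (-1) t (s + t) * ff (s + t)) := by
  have := triple (-1) (by ring) s t hs
  simpa only [tri_sign] using this

theorem triple_pos (s t : ℕ) (hs : 0 < s) :
    HasSum (fun k : ℤ => (monomial (s * tri k + t * tri (k - 1)) 1 : K7⟦X⟧))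
      (gp 1 s (s + t) * gp 1 t (s + t) * ff (s + t)) := by
  have := triple 1 (by ring) s t hs
  simpa only [one_pow, one_mul] using this

theorem one_add_nat_eps {A : Type*} [CommRing A] (n : ℕ) (c : A) :
    (1 + TrivSqZeroExt.inr c : DualNumber A) ^ n = 1 + TrivSqZeroExt.inr ((n : A) * c) := by
  induction n with
  | zero => simp
  | succ n ih =>
    rw [pow_succ, ih]
    ext <;> simp
    ring

/-- The Jacobi identity, before passing to the limit. -/
theorem finite_jacobi {A : Type*} [CommRing A] (q : A) (N : ℕ) :
    qp q (N + 1) * qp q N = ∑ i ∈ Finset.range (N + 1 + (N + 1) + 1), qb q (N + 1 + (N + 1)) i *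
      (q ^ tri ((i : ℤ) - (N + 1 : ℕ)) * ((-1) ^ tri ((i : ℤ) - (N + 1 : ℕ)) *
        (-1) ^ tri ((i : ℤ) - (N + 1 : ℕ) - 1) * (((i : ℤ) - (N + 1 : ℕ) : ℤ) : A))) := by
  let E : DualNumber A := TrivSqZeroExt.inr 1
  let E' : DualNumber A := TrivSqZeroExt.inr (-1)
  let a : DualNumber A := TrivSqZeroExt.inlHom A A (-q) * (1 + E)
  let b : DualNumber A := TrivSqZeroExt.inlHom A A (-1) * (1 + E')
  have hab : a * b = TrivSqZeroExt.inlHom A A q := by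
    ext <;> simp [a, b, E, E']
  have h := finite_triple a b (N + 1) (N + 1)
  rw [hab] at h
  have hs := congrArg TrivSqZeroExt.snd h
  rw [TrivSqZeroExt.snd_sum] at hs
  have hR : ∀ i ∈ Finset.range (N + 1 + (N + 1) + 1),
      TrivSqZeroExt.snd (qb (TrivSqZeroExt.inlHom A A q) (N + 1 + (N + 1)) i *
        (a ^ tri ((i : ℤ) - (N + 1 : ℕ)) * b ^ tri ((i : ℤ) - (N + 1 : ℕ) - 1))) =
      qb q (N + 1 + (N + 1)) i *
      (q ^ tri ((i : ℤ) - (N + 1 : ℕ)) * ((-1) ^ tri ((i : ℤ) - (N + 1 : ℕ)) *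
        (-1) ^ tri ((i : ℤ) - (N + 1 : ℕ) - 1) * (((i : ℤ) - (N + 1 : ℕ) : ℤ) : A))) := by
    intro i _
    generalize ((i : ℤ) - (N + 1 : ℕ)) = k
    have hk : (k : A) = (tri k : A) - (tri (k - 1) : A) := by
      have h1 := tri_spec k
      have h2 := tri_spec (k - 1)
      have : k = (tri k : ℤ) - (tri (k - 1) : ℤ) := by linarith
      have h3 := congrArg (Int.cast : ℤ → A) this
      simpa using h3
    rw [← qb_map, hk]
    simp only [a, b, mul_pow, E, E', one_add_nat_eps, ← map_pow]
    rw [neg_pow q]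
    simp
    ring
  rw [Finset.sum_congr rfl hR] at hs
  rw [← hs]
  have hb : ∏ k ∈ Finset.range (N + 1), (1 + b * (TrivSqZeroExt.inlHom A A q) ^ k) =
      E * ∏ k ∈ Finset.range N, (1 + b * (TrivSqZeroExt.inlHom A A q) ^ (k + 1)) := by
    rw [Finset.prod_range_succ', mul_comm]
    congr 1
    ext <;> simp [b, E, E']
  rw [hb]
  have hE : ∀ x y : DualNumber A, TrivSqZeroExt.snd (x * (E * y)) =
      TrivSqZeroExt.fstHom A A A x * TrivSqZeroExt.fstHom A A A y := by
    intro x y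
    simp [E]
  rw [hE, map_prod, map_prod]
  unfold qp
  congr 1
  · refine Finset.prod_congr rfl fun k _ => ?_
    simp [a, E]
    ring
  · refine Finset.prod_congr rfl fun k _ => ?_
    simp [b, E']
    ring

theorem jacobi (c : ℕ) (hc : 0 < c) :
    HasSum (fun k : ℤ => (monomial (c * tri k) ((-1) ^ k * (k : K7)) : K7⟦X⟧)) (ff c ^ 3) := by
  have hge : ∀ k : ℤ, k.natAbs ≤ c * tri k + 1 := fun k => by
    have := tri_exp_ge c 0 hc k
    omega
  have := hasSum_of_finite c hc (fun k => c * tri k) hge (fun k => (-1) ^ k * (k : K7))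
    (fun N => ∑ i ∈ Finset.range (N + N + 1), qb (X ^ c) (N + N) i *
      monomial (c * tri ((i : ℤ) - N)) ((-1) ^ ((i : ℤ) - N) * (((i : ℤ) - N : ℤ) : K7)))
    (ff c * ff c) ?_ (fun N => rfl)
  · convert this using 1; ring
  rw [← tendsto_add_atTop_iff_nat 1]
  have h1 := (tendsto_gpp (-1) c c hc).comp (tendsto_add_atTop_nat 1)
  refine (h1.mul (tendsto_gpp (-1) c c hc)).congr fun N => ?_
  simp only [Function.comp]
  rw [← qp_eq, ← qp_eq, finite_jacobi]
  refine Finset.sum_congr rfl fun i _ => ?_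
  congr 1
  rw [← tri_sign, monomial_eq_C_mul_X_pow, ← pow_mul]
  simp
  ring

theorem ff_split (c : ℕ) (hc : 0 < c) : ff c = gp (-1) c (2 * c) * ff (2 * c) := by
  have := gp_split2 (-1) c c hc
  unfold ff
  rw [this]
  congr 2
  ring

/-- `φ(-q^c)`. -/
noncomputable def pn (c : ℕ) : K7⟦X⟧ := gp (-1) c (c + c) * gp (-1) c (c + c) * ff (c + c)

/-- `φ(q^c)`. -/
noncomputable def pp (c : ℕ) : K7⟦X⟧ := gp 1 c (c + c) * gp 1 c (c + c) * ff (c + c)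

/-- `2 ψ(q^c)`. -/
noncomputable def ps (c : ℕ) : K7⟦X⟧ := gp 1 c (c + 0) * gp 1 0 (c + 0) * ff (c + 0)

theorem pn_mul (c : ℕ) (hc : 0 < c) : pn c * ff (2 * c) = ff c ^ 2 := by
  unfold pn
  rw [ff_split c hc, ← two_mul]
  ring

theorem pp_mul (c : ℕ) (hc : 0 < c) : pp c * (ff c ^ 2 * ff (4 * c) ^ 2) = ff (2 * c) ^ 5 := by
  unfold pp
  have h1 := gp_pm c (2 * c) (by omega)
  have h2 := ff_split (2 * c) (by omega)
  have h3 : 2 * (2 * c) = 4 * c := by ring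
  rw [h3] at h1 h2
  rw [ff_split c hc, ← two_mul]
  have : gp 1 c (2 * c) * gp 1 c (2 * c) * ff (2 * c) *
      ((gp (-1) c (2 * c) * ff (2 * c)) ^ 2 * ff (4 * c) ^ 2) =
      (gp 1 c (2 * c) * gp (-1) c (2 * c)) ^ 2 * ff (4 * c) ^ 2 * ff (2 * c) ^ 3 := by ring
  rw [this, h1, ← mul_pow, ← h2]
  ring

theorem ps_mul (c : ℕ) (hc : 0 < c) : ps c * ff c = 2 * ff (2 * c) ^ 2 := by
  unfold ps
  have h1 := gp_pm c c hc
  have h2 := gp_shift 1 0 c hc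
  rw [zero_add] at h2
  rw [add_zero, h2]
  change gp 1 c c * ff c = ff (2 * c) at h1
  rw [← h1]
  simp only [map_one, pow_zero]
  ring

theorem pent (c : ℕ) (hc : 0 < c) :
    HasSum (fun k : ℤ => (monomial (2 * c * tri k + c * tri (k - 1)) ((-1) ^ k) : K7⟦X⟧))
      (ff c) := by
  have := triple_neg (2 * c) c (by omega)
  convert this using 1
  have h := gp_split3 (-1) c c hc
  have e1 : 2 * c + c = 3 * c := by ring
  have e2 : c + c = 2 * c := by ring
  have e3 : c + 2 * c = 3 * c := by ring
  rw [e1]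
  rw [e2, e3] at h
  unfold ff
  rw [h]
  ring

theorem tri_neg (k : ℤ) : tri (-k) = tri (k - 1) := by
  have h1 := tri_spec (-k)
  have h2 := tri_spec (k - 1)
  zify
  linarith

theorem hasSum_zero_of_inv {ι : Type*} {f : ι → K7⟦X⟧} (hf : Summable f) (σ : ι ≃ ι)
    (h : ∀ i, f (σ i) = -f i) : HasSum f 0 := by
  obtain ⟨S, hS⟩ := hf
  have h1 : HasSum (f ∘ σ) S := (σ.hasSum_iff).2 hS
  have h2 : f ∘ σ = fun i => -f i := funext h
  rw [h2] at h1
  have h3 := h1.unique hS.neg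
  have h4 : (2 : K7⟦X⟧) * S = 0 := by linear_combination h3
  have h5 : (4 : K7) * 2 = 1 := by decide
  have h6 : (C (4 : K7) : K7⟦X⟧) * 2 = 1 := by
    have := congrArg (C : K7 →+* K7⟦X⟧) h5
    rwa [map_mul, map_one, map_ofNat C 2] at this
  have : S = 0 := by linear_combination C (4 : K7) * h4 - S * h6
  rwa [this] at hS

theorem hasSum_split2 {g : ℤ → K7⟦X⟧} {A B : K7⟦X⟧} (h0 : HasSum (fun k => g (2 * k)) A)
    (h1 : HasSum (fun k => g (2 * k + 1)) B) : HasSum g (A + B) := by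
  have i0 : Function.Injective fun k : ℤ => 2 * k := fun a b h => by simp only at h; omega
  have i1 : Function.Injective fun k : ℤ => 2 * k + 1 := fun a b h => by simp only at h; omega
  have h0' := (i0.hasSum_range_iff (f := g)).2 h0
  have h1' := (i1.hasSum_range_iff (f := g)).2 h1
  refine HasSum.add_isCompl ?_ h0' h1'
  constructor
  · rw [Set.disjoint_left]
    rintro _ ⟨a, rfl⟩ ⟨b, hb⟩
    simp only at hb
    omega
  · rw [codisjoint_iff_le_sup]
    rintro x -
    rcases Int.even_or_odd' x with ⟨k, hk | hk⟩
    · exact Or.inl ⟨k, hk.symm⟩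
    · exact Or.inr ⟨k, hk.symm⟩

theorem hasSum_split3 {g : ℤ × ℤ → K7⟦X⟧} {A B D : K7⟦X⟧}
    (h0 : HasSum (fun p : ℤ × ℤ => g (p.2 - 2 * p.1, p.1 + p.2)) A)
    (h1 : HasSum (fun p : ℤ × ℤ => g (p.2 + 1 - 2 * p.1, p.1 + p.2)) B)
    (h2 : HasSum (fun p : ℤ × ℤ => g (p.2 + 2 - 2 * p.1, p.1 + p.2)) D) :
    HasSum g (A + B + D) := by
  have inj : ∀ r : ℤ, Function.Injective
      fun p : ℤ × ℤ => ((p.2 + r - 2 * p.1, p.1 + p.2) : ℤ × ℤ) := by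
    rintro r ⟨a, b⟩ ⟨a', b'⟩ h
    simp only [Prod.mk.injEq] at h ⊢
    omega
  have i0 := inj 0
  simp only [add_zero] at i0
  have h0' := (i0.hasSum_range_iff (f := g)).2 h0
  have h1' := ((inj 1).hasSum_range_iff (f := g)).2 h1
  have h2' := ((inj 2).hasSum_range_iff (f := g)).2 h2
  refine HasSum.add_isCompl ?_ (HasSum.add_disjoint ?_ h0' h1') h2'
  · constructor
    · rw [Set.disjoint_left]
      rintro _ (⟨⟨a, b⟩, rfl⟩ | ⟨⟨a, b⟩, rfl⟩) ⟨⟨a', b'⟩, hb⟩ <;>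
        simp only [Prod.mk.injEq] at hb <;> omega
    · rw [codisjoint_iff_le_sup]
      rintro ⟨i, j⟩ -
      have h3 : (i + 2 * j) % 3 = 0 ∨ (i + 2 * j) % 3 = 1 ∨ (i + 2 * j) % 3 = 2 := by omega
      rcases h3 with h | h | h
      · refine Or.inl (Or.inl ⟨(j - (i + 2 * j) / 3, (i + 2 * j) / 3), ?_⟩)
        simp only [Prod.mk.injEq]; omega
      · refine Or.inl (Or.inr ⟨(j - (i + 2 * j) / 3, (i + 2 * j) / 3), ?_⟩)
        simp only [Prod.mk.injEq]; omega
      · refine Or.inr ⟨(j - (i + 2 * j) / 3, (i + 2 * j) / 3), ?_⟩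
        simp only [Prod.mk.injEq]; omega
  · rw [Set.disjoint_left]
    rintro _ ⟨⟨a, b⟩, rfl⟩ ⟨⟨a', b'⟩, hb⟩
    simp only [Prod.mk.injEq] at hb
    omega

theorem pn_hasSum (c : ℕ) (hc : 0 < c) :
    HasSum (fun k : ℤ => (monomial (c * tri k + c * tri (k - 1)) ((-1) ^ k) : K7⟦X⟧)) (pn c) :=
  triple_neg c c hc

theorem pp_hasSum (c : ℕ) (hc : 0 < c) :
    HasSum (fun k : ℤ => (monomial (c * tri k + c * tri (k - 1)) 1 : K7⟦X⟧)) (pp c) :=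
  triple_pos c c hc

theorem ps_hasSum (c : ℕ) (hc : 0 < c) :
    HasSum (fun k : ℤ => (monomial (c * tri k) 1 : K7⟦X⟧)) (ps c) := by
  have := triple_pos c 0 hc
  simp only [zero_mul, add_zero] at this
  unfold ps
  simpa only [add_zero] using this

theorem sq_even (c : ℕ) (k : ℤ) : c * tri (2 * k) + c * tri (2 * k - 1) =
    4 * c * tri k + 4 * c * tri (k - 1) := by
  have h1 := tri_spec (2 * k)
  have h2 := tri_spec (2 * k - 1)
  have h3 := tri_spec k
  have h4 := tri_spec (k - 1)
  zify
  have : (tri (2 * k) : ℤ) + tri (2 * k - 1) = 4 * tri k + 4 * tri (k - 1) := by linarith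
  linear_combination (c : ℤ) * this

theorem sq_odd (c : ℕ) (k : ℤ) : c * tri (2 * k + 1) + c * tri (2 * k + 1 - 1) =
    c + 8 * c * tri k := by
  have h1 := tri_spec (2 * k + 1)
  have h2 := tri_spec (2 * k + 1 - 1)
  have h3 := tri_spec k
  zify
  have : (tri (2 * k + 1) : ℤ) + tri (2 * k + 1 - 1) = 1 + 8 * tri k := by linarith
  linear_combination (c : ℤ) * this

theorem ps_shift (c : ℕ) (hc : 0 < c) (u : K7) :
    HasSum (fun k : ℤ => (monomial (c + 8 * c * tri k) u : K7⟦X⟧)) (C u * X ^ c * ps (8 * c)) := by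
  have := (ps_hasSum (8 * c) (by omega)).mul_left (C u * X ^ c)
  rw [← monomial_eq_C_mul_X_pow] at this ⊢
  simpa only [monomial_mul_monomial, mul_one] using this

theorem pp_dissect (c : ℕ) (hc : 0 < c) : pp c = pp (4 * c) + X ^ c * ps (8 * c) := by
  refine (pp_hasSum c hc).unique (hasSum_split2 ?_ ?_)
  · simp only [sq_even]
    exact pp_hasSum (4 * c) (by omega)
  · simp only [sq_odd]
    have := ps_shift c hc 1
    rwa [map_one, one_mul] at this

theorem pn_dissect (c : ℕ) (hc : 0 < c) : pn c = pp (4 * c) - X ^ c * ps (8 * c) := by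
  rw [sub_eq_add_neg]
  refine (pn_hasSum c hc).unique (hasSum_split2 ?_ ?_)
  · simp only [sq_even, (even_two_mul _).neg_one_zpow]
    exact pp_hasSum (4 * c) (by omega)
  · simp only [sq_odd, (odd_two_mul_add_one _).neg_one_zpow]
    have := ps_shift c hc (-1)
    rwa [map_neg, map_one, mul_assoc, neg_one_mul] at this

/-- The rearrangement of a two-dimensional theta series. -/
theorem double_sum {e1 e2 p1 p2 p3 r1 r2 r3 : ℤ → ℕ} (he1 : Proper e1) (he2 : Proper e2)
    (hp1 : Proper p1) (hp2 : Proper p2) (hp3 : Proper p3)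
    (hr1 : Proper r1) (hr2 : Proper r2) (hr3 : Proper r3)
    (q0 : ∀ s j, e1 (s - 2 * j) + e2 (j + s) = p1 j + r1 s)
    (q1 : ∀ s j, e1 (s + 1 - 2 * j) + e2 (j + s) = p2 j + r2 s)
    (q2 : ∀ s j, e1 (s + 2 - 2 * j) + e2 (j + s) = p3 j + r3 s)
    {A0 A1 B0 B1 P1 P2 R1 R2 : K7⟦X⟧}
    (hA0 : HasSum (fun k : ℤ => (monomial (e1 k) ((-1) ^ k) : K7⟦X⟧)) A0)
    (hA1 : HasSum (fun k : ℤ => (monomial (e1 k) ((-1) ^ k * (k : K7)) : K7⟦X⟧)) A1)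
    (hB0 : HasSum (fun k : ℤ => (monomial (e2 k) ((-1) ^ k) : K7⟦X⟧)) B0)
    (hB1 : HasSum (fun k : ℤ => (monomial (e2 k) ((-1) ^ k * (k : K7)) : K7⟦X⟧)) B1)
    (hP1 : HasSum (fun k : ℤ => (monomial (p1 k) ((-1) ^ k) : K7⟦X⟧)) P1)
    (hP2 : HasSum (fun k : ℤ => (monomial (p2 k) ((-1) ^ k) : K7⟦X⟧)) P2)
    (hP3 : HasSum (fun k : ℤ => (monomial (p3 k) ((-1) ^ k) : K7⟦X⟧)) 0)
    (hR1 : HasSum (fun k : ℤ => (monomial (r1 k) (3 * (k : K7)) : K7⟦X⟧)) R1)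
    (hR2 : HasSum (fun k : ℤ => (monomial (r2 k) (3 * (k : K7) + 1) : K7⟦X⟧)) R2) :
    A1 * B0 + 2 * (A0 * B1) = P1 * R1 - P2 * R2 := by
  obtain ⟨R3, hR3⟩ := hr3.summable fun k : ℤ => 3 * (k : K7) + 2
  have hL := (he1.hasSum_mul he2 hA1 hB0).add ((he1.hasSum_mul he2 hA0 hB1).mul_left (C (2 : K7)))
  have h0 := hp1.hasSum_mul hr1 hP1 hR1
  have h1 := (hp2.hasSum_mul hr2 hP2 hR2).neg
  have h2 := hp3.hasSum_mul hr3 hP3 hR3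
  have sgn : ∀ (r s j : ℤ), (-1 : K7) ^ (s + r - 2 * j) * (-1) ^ (j + s) = (-1) ^ r * (-1) ^ j := by
    intro r s j
    have h7 : (-1 : K7) ≠ 0 := by decide
    rw [← zpow_add₀ h7, ← zpow_add₀ h7, show s + r - 2 * j + (j + s) = 2 * (s - j) + (r + j) by ring,
      zpow_add₀ h7, (even_two_mul _).neg_one_zpow, one_mul]
  have hS := hasSum_split3 (g := fun p : ℤ × ℤ =>
    (monomial (e1 p.1 + e2 p.2) ((-1) ^ p.1 * (-1) ^ p.2 * ((p.1 : K7) + 2 * (p.2 : K7))) : K7⟦X⟧))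
    (A := P1 * R1) (B := -(P2 * R2)) (D := 0 * R3) ?_ ?_ ?_
  · have e : (fun p : ℤ × ℤ => (monomial (e1 p.1 + e2 p.2)
        ((-1) ^ p.1 * (-1) ^ p.2 * ((p.1 : K7) + 2 * (p.2 : K7))) : K7⟦X⟧)) =
        fun p : ℤ × ℤ => monomial (e1 p.1 + e2 p.2) ((-1) ^ p.1 * (p.1 : K7) * (-1) ^ p.2) +
        C (2 : K7) * monomial (e1 p.1 + e2 p.2) ((-1) ^ p.1 * ((-1) ^ p.2 * (p.2 : K7))) := by
      funext p
      rw [← smul_eq_C_mul, ← map_smul, ← map_add, smul_eq_mul]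
      congr 1
      ring
    rw [e] at hS
    have := hL.unique hS
    rw [map_ofNat C 2] at this
    rw [this]; ring
  · refine (congrArg (fun f => HasSum f (P1 * R1)) (funext fun p => ?_)).mpr h0
    dsimp only
    have h := sgn 0 p.2 p.1
    rw [add_zero, zpow_zero, one_mul] at h
    rw [q0, h]
    congr 1
    push_cast; ring
  · refine (congrArg (fun f => HasSum f (-(P2 * R2))) (funext fun p => ?_)).mpr h1
    dsimp only
    rw [q1, sgn 1 p.2 p.1, zpow_one, ← map_neg]
    congr 1
    push_cast; ring
  · refine (congrArg (fun f => HasSum f (0 * R3)) (funext fun p => ?_)).mpr h2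
    dsimp only
    rw [q2, sgn 2 p.2 p.1, even_two.neg_one_zpow]
    congr 1
    push_cast; ring

theorem Proper.comp_equiv {e : ℤ → ℕ} (h : Proper e) (σ : ℤ ≃ ℤ) : Proper fun k => e (σ k) := by
  intro n
  exact (h n).preimage σ.injective.injOn

theorem Proper.mono {e e' : ℤ → ℕ} (h : Proper e) (hle : ∀ k, e k ≤ e' k) : Proper e' := by
  intro n
  refine (h n).subset fun k hk => ?_
  simp only [Set.mem_ofPred_eq] at hk ⊢
  exact (hle k).trans hk

theorem proper_tri0 (c : ℕ) (hc : 0 < c) : Proper fun k : ℤ => c * tri k :=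
  (proper_tri c 0 hc).mono fun k => by omega

theorem proper_tri_sub (c : ℕ) (hc : 0 < c) : Proper fun k : ℤ => c * tri (k - 1) :=
  (proper_tri0 c hc).comp_equiv (Equiv.subRight 1)

theorem neg_one_zpow_neg (k : ℤ) : (-1 : K7) ^ (-k) = (-1) ^ k := by
  rw [zpow_neg, ← inv_zpow, show (-1 : K7)⁻¹ = -1 by rw [inv_neg, inv_one]]

theorem neg_one_zpow_sub_one (k : ℤ) : (-1 : K7) ^ (1 - k) = -(-1) ^ k := by
  have h7 : (-1 : K7) ≠ 0 := by decide
  rw [sub_eq_add_neg, zpow_add₀ h7, neg_one_zpow_neg, zpow_one, neg_one_mul]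

theorem neg_one_zpow_neg_one_sub (k : ℤ) : (-1 : K7) ^ (-1 - k) = -(-1) ^ k := by
  have h7 : (-1 : K7) ≠ 0 := by decide
  rw [sub_eq_add_neg, zpow_add₀ h7, neg_one_zpow_neg, neg_one_zpow_neg, zpow_one, neg_one_mul]

theorem tri_one_sub (k : ℤ) : tri (1 - k - 1) = tri (k - 1) := by
  rw [show 1 - k - 1 = -k by ring, tri_neg]

theorem tri_neg_one_sub (k : ℤ) : tri (-1 - k) = tri k := by
  rw [show -1 - k = -(k + 1) by ring, tri_neg, add_sub_cancel_right]

theorem zero_tri_sub (c : ℕ) (hc : 0 < c) :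
    HasSum (fun k : ℤ => (monomial (c * tri (k - 1)) ((-1) ^ k) : K7⟦X⟧)) 0 := by
  refine hasSum_zero_of_inv ((proper_tri_sub c hc).summable _) (Equiv.subLeft 1) fun k => ?_
  simp only [Equiv.subLeft_apply]
  rw [tri_one_sub, neg_one_zpow_sub_one, map_neg]

theorem zero_tri (c : ℕ) (hc : 0 < c) :
    HasSum (fun k : ℤ => (monomial (c * tri k) ((-1) ^ k) : K7⟦X⟧)) 0 := by
  refine hasSum_zero_of_inv ((proper_tri0 c hc).summable _) (Equiv.subLeft (-1)) fun k => ?_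
  simp only [Equiv.subLeft_apply]
  rw [tri_neg_one_sub, neg_one_zpow_neg_one_sub, map_neg]

theorem jacobi_neg (c : ℕ) (hc : 0 < c) :
    HasSum (fun k : ℤ => (monomial (c * tri (k - 1)) ((-1) ^ k * (k : K7)) : K7⟦X⟧))
      (-ff c ^ 3) := by
  have h := ((Equiv.neg ℤ).hasSum_iff.2 (jacobi c hc)).neg
  refine (congrArg (fun f => HasSum f (-ff c ^ 3)) (funext fun k => ?_)).mpr h
  simp only [Function.comp, Equiv.neg_apply]
  rw [tri_neg, neg_one_zpow_neg, ← map_neg]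
  congr 1
  push_cast; ring

theorem jacobi_sym (c : ℕ) (hc : 0 < c) :
    HasSum (fun k : ℤ => (monomial (c * tri k) ((-1) ^ k * (2 * (k : K7) + 1)) : K7⟦X⟧))
      (2 * ff c ^ 3) := by
  have h := ((jacobi c hc).add (jacobi c hc)).add (zero_tri c hc)
  rw [add_zero, ← two_mul] at h
  refine (congrArg (fun f => HasSum f (2 * ff c ^ 3)) (funext fun k => ?_)).mpr h
  simp only [← map_add]
  congr 1
  ring

theorem pent_neg (c : ℕ) (hc : 0 < c) :
    HasSum (fun k : ℤ => (monomial (2 * c * tri (k - 1) + c * tri k) ((-1) ^ k) : K7⟦X⟧))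
      (ff c) := by
  have h := (Equiv.neg ℤ).hasSum_iff.2 (pent c hc)
  refine (congrArg (fun f => HasSum f (ff c)) (funext fun k => ?_)).mpr h
  simp only [Function.comp, Equiv.neg_apply]
  rw [tri_neg, neg_one_zpow_neg, show -k - 1 = -(k + 1) by ring, tri_neg, add_sub_cancel_right]

theorem rr_exists (c : ℕ) (hc : 0 < c) : ∃ R : K7⟦X⟧,
    HasSum (fun k : ℤ => (monomial (2 * c * tri k + c * tri (k - 1)) (6 * (k : K7) + 1) : K7⟦X⟧)) R ∧
    R * ff (2 * c) ^ 2 = ff c ^ 5 := by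
  have pr1 : Proper fun k : ℤ => c * tri k + 2 * c * tri (k - 1) := proper_tri _ _ hc
  have pr2 : Proper fun k : ℤ => 2 * c * tri k + c * tri (k - 1) := proper_tri _ _ (by omega)
  have pr3 : Proper fun k : ℤ => 3 * c * tri k + c := 
    (proper_tri0 (3 * c) (by omega)).mono fun k => by omega
  have pp2 : Proper fun k : ℤ => 2 * (2 * c) * tri (k - 1) + 2 * c * tri k :=
    (proper_tri0 (2 * c) (by omega)).mono fun k => by omega
  obtain ⟨R1, hR1⟩ := pr1.summable fun k : ℤ => 3 * (k : K7)
  obtain ⟨R2, hR2⟩ := pr2.summable fun k : ℤ => 3 * (k : K7) + 1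
  obtain ⟨B1, hB1⟩ := (proper_tri c c hc).summable fun k : ℤ => (-1) ^ k * (k : K7)
  have key := double_sum (e1 := fun k => c * tri (k - 1))
    (e2 := fun k => c * tri k + c * tri (k - 1))
    (p1 := fun k => 2 * (2 * c) * tri k + 2 * c * tri (k - 1))
    (p3 := fun k => 6 * c * tri (k - 1))
    (proper_tri_sub c hc) (proper_tri c c hc)
    (proper_tri _ _ (by omega)) pp2 (proper_tri_sub _ (by omega)) pr1 pr2 pr3
    ?_ ?_ ?_ (zero_tri_sub c hc) (jacobi_neg c hc) (pn_hasSum c hc) hB1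
    (pent (2 * c) (by omega)) (pent_neg (2 * c) (by omega)) (zero_tri_sub _ (by omega)) hR1 hR2
  · refine ⟨R2 - R1, ?_, ?_⟩
    · have h1 := (Equiv.neg ℤ).hasSum_iff.2 hR1
      have h := hR2.sub h1
      refine (congrArg (fun f => HasSum f (R2 - R1)) (funext fun k => ?_)).mpr h
      simp only [Function.comp, Equiv.neg_apply]
      rw [tri_neg, show -k - 1 = -(k + 1) by ring, tri_neg, add_sub_cancel_right,
        add_comm (c * tri (k - 1)), ← map_sub]
      congr 1
      push_cast; ring
    · have h2 := pn_mul c hc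
      linear_combination ff (2 * c) * key + ff c ^ 3 * h2
  · intro s j
    have h1 := tri_spec (s - 2 * j - 1)
    have h2 := tri_spec (j + s)
    have h3 := tri_spec (j + s - 1)
    have h4 := tri_spec j
    have h5 := tri_spec (j - 1)
    have h6 := tri_spec s
    have h7 := tri_spec (s - 1)
    zify
    have : (tri (s - 2 * j - 1) : ℤ) + (tri (j + s) + tri (j + s - 1)) =
      4 * tri j + 2 * tri (j - 1) + (tri s + 2 * tri (s - 1)) := by linarith
    linear_combination (c : ℤ) * this
  · intro s j
    have h1 := tri_spec (s + 1 - 2 * j - 1)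
    have h2 := tri_spec (j + s)
    have h3 := tri_spec (j + s - 1)
    have h4 := tri_spec j
    have h5 := tri_spec (j - 1)
    have h6 := tri_spec s
    have h7 := tri_spec (s - 1)
    zify
    have : (tri (s + 1 - 2 * j - 1) : ℤ) + (tri (j + s) + tri (j + s - 1)) =
      4 * tri (j - 1) + 2 * tri j + (2 * tri s + tri (s - 1)) := by linarith
    linear_combination (c : ℤ) * this
  · intro s j
    have h1 := tri_spec (s + 2 - 2 * j - 1)
    have h2 := tri_spec (j + s)
    have h3 := tri_spec (j + s - 1)
    have h5 := tri_spec (j - 1)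
    have h6 := tri_spec s
    zify
    have : (tri (s + 2 - 2 * j - 1) : ℤ) + (tri (j + s) + tri (j + s - 1)) =
      6 * tri (j - 1) + (3 * tri s + 1) := by linarith
    linear_combination (c : ℤ) * this

theorem ss_exists (c : ℕ) (hc : 0 < c) : ∃ R : K7⟦X⟧,
    HasSum (fun k : ℤ => (monomial (5 * c * tri k + c * tri (k - 1)) (6 * (k : K7) + 2) : K7⟦X⟧)) R ∧
    R * ff (2 * c) = 2 * ff (4 * c) ^ 2 * ff c ^ 2 := by
  have pr1 : Proper fun k : ℤ => 5 * c * tri k + c * tri (k - 1) := proper_tri _ _ (by omega)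
  have pr2 : Proper fun k : ℤ => 5 * c * tri k + c * tri (k + 1) :=
    (proper_tri0 (5 * c) (by omega)).mono fun k => by omega
  have pr3 : Proper fun k : ℤ => 3 * c * tri k + (3 * c * tri (k + 1) + c) :=
    (proper_tri0 (3 * c) (by omega)).mono fun k => by omega
  have pp2 : Proper fun k : ℤ => 2 * (4 * c) * tri (k - 1) + 4 * c * tri k :=
    (proper_tri0 (4 * c) (by omega)).mono fun k => by omega
  obtain ⟨R1, hR1⟩ := pr1.summable fun k : ℤ => 3 * (k : K7)
  obtain ⟨R2, hR2⟩ := pr2.summable fun k : ℤ => 3 * (k : K7) + 1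
  obtain ⟨A1, hA1⟩ := (proper_tri c c hc).summable fun k : ℤ => (-1) ^ k * (k : K7)
  have key := double_sum (e1 := fun k => c * tri k + c * tri (k - 1))
    (e2 := fun k => 4 * c * tri k)
    (p1 := fun k => 2 * (4 * c) * tri k + 4 * c * tri (k - 1))
    (p3 := fun k => 12 * c * tri (k - 1))
    (proper_tri c c hc) (proper_tri0 _ (by omega))
    (proper_tri _ _ (by omega)) pp2 (proper_tri_sub _ (by omega)) pr1 pr2 pr3
    ?_ ?_ ?_ (pn_hasSum c hc) hA1 (zero_tri (4 * c) (by omega)) (jacobi (4 * c) (by omega))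
    (pent (4 * c) (by omega)) (pent_neg (4 * c) (by omega)) (zero_tri_sub _ (by omega)) hR1 hR2
  · refine ⟨R1 - R2, ?_, ?_⟩
    · have h1 := (Equiv.subLeft (-1 : ℤ)).hasSum_iff.2 hR2
      have h := hR1.sub h1
      refine (congrArg (fun f => HasSum f (R1 - R2)) (funext fun k => ?_)).mpr h
      simp only [Function.comp, Equiv.subLeft_apply]
      rw [tri_neg_one_sub, show -1 - k + 1 = -k by ring, tri_neg, ← map_sub]
      congr 1
      push_cast; ring
    · have h2 := pn_mul c hc
      refine mul_left_cancel₀ (ff_ne_zero (4 * c) (by omega)) ?_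
      linear_combination (-ff (2 * c)) * key + 2 * ff (4 * c) ^ 3 * h2
  · intro s j
    have h1 := tri_spec (s - 2 * j)
    have h2 := tri_spec (s - 2 * j - 1)
    have h3 := tri_spec (j + s)
    have h4 := tri_spec j
    have h5 := tri_spec (j - 1)
    have h6 := tri_spec s
    have h7 := tri_spec (s - 1)
    zify
    have : (tri (s - 2 * j) : ℤ) + tri (s - 2 * j - 1) + 4 * tri (j + s) =
      8 * tri j + 4 * tri (j - 1) + (5 * tri s + tri (s - 1)) := by linarith
    linear_combination (c : ℤ) * this
  · intro s j
    have h1 := tri_spec (s + 1 - 2 * j)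
    have h2 := tri_spec (s + 1 - 2 * j - 1)
    have h3 := tri_spec (j + s)
    have h4 := tri_spec j
    have h5 := tri_spec (j - 1)
    have h6 := tri_spec s
    have h7 := tri_spec (s + 1)
    zify
    have : (tri (s + 1 - 2 * j) : ℤ) + tri (s + 1 - 2 * j - 1) + 4 * tri (j + s) =
      8 * tri (j - 1) + 4 * tri j + (5 * tri s + tri (s + 1)) := by linarith
    linear_combination (c : ℤ) * this
  · intro s j
    have h1 := tri_spec (s + 2 - 2 * j)
    have h2 := tri_spec (s + 2 - 2 * j - 1)
    have h3 := tri_spec (j + s)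
    have h5 := tri_spec (j - 1)
    have h6 := tri_spec s
    have h7 := tri_spec (s + 1)
    zify
    have : (tri (s + 2 - 2 * j) : ℤ) + tri (s + 2 - 2 * j - 1) + 4 * tri (j + s) =
      12 * tri (j - 1) + (3 * tri s + (3 * tri (s + 1) + 1)) := by linarith
    linear_combination (c : ℤ) * this

/-- `Supp F S`: the exponents occurring in `F` have residues modulo `7` in `S`. -/
def Supp (F : K7⟦X⟧) (S : Finset K7) : Prop := ∀ n : ℕ, (n : K7) ∉ S → coeff n F = 0

theorem Supp.mul {F G : K7⟦X⟧} {S T : Finset K7} (hF : Supp F S) (hG : Supp G T) :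
    Supp (F * G) (Finset.image₂ (· + ·) S T) := by
  intro n hn
  rw [coeff_mul]
  refine Finset.sum_eq_zero fun p hp => ?_
  by_cases h1 : (p.1 : K7) ∈ S
  · by_cases h2 : (p.2 : K7) ∈ T
    · exfalso
      apply hn
      rw [← Finset.HasAntidiagonal.mem_antidiagonal.1 hp, Nat.cast_add]
      exact Finset.mem_image₂_of_mem h1 h2
    · rw [hG _ h2, mul_zero]
  · rw [hF _ h1, zero_mul]

theorem Supp.sub {F G : K7⟦X⟧} {S T : Finset K7} (hF : Supp F S) (hG : Supp G T) :
    Supp (F - G) (S ∪ T) := by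
  intro n hn
  rw [Finset.mem_union, not_or] at hn
  rw [map_sub, hF n hn.1, hG n hn.2, sub_zero]

theorem supp_X_pow (m : ℕ) : Supp (X ^ m) {(m : K7)} := by
  intro n hn
  rw [coeff_X_pow, if_neg]
  rintro rfl
  exact hn (Finset.mem_singleton_self _)

theorem supp_pow_seven (F : K7⟦X⟧) : Supp (F ^ 7) {0} := by
  intro n hn
  have h : d⁄dX K7 (F ^ 7) = 0 := by
    rw [Derivation.leibniz_pow, ← Nat.cast_smul_eq_nsmul K7, show ((7 : ℕ) : K7) = 0 by decide,
      zero_smul]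
  cases n with
  | zero => simp at hn
  | succ n =>
    have h2 := congrArg (coeff n) h
    rw [coeff_derivative, map_zero] at h2
    rw [Finset.mem_singleton] at hn
    push_cast at hn
    exact (mul_eq_zero.1 h2).resolve_right hn

theorem supp_hasSum {e : ℤ → ℕ} {u : ℤ → K7} {F : K7⟦X⟧} {S : Finset K7}
    (h : HasSum (fun k : ℤ => (monomial (e k) (u k) : K7⟦X⟧)) F)
    (hS : ∀ k, u k ≠ 0 → (e k : K7) ∈ S) : Supp F S := by
  intro n hn
  rw [hasSum_iff_hasSum_coeff] at h
  refine (h n).unique ?_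
  have e : (fun i : ℤ => coeff n (monomial (e i) (u i) : K7⟦X⟧)) = fun _ => 0 := by
    funext i
    rw [coeff_monomial]
    split_ifs with hi
    · by_contra hu
      exact hn (hi ▸ hS i hu)
    · rfl
  rw [e]
  exact hasSum_zero

theorem tri_cast (k : ℤ) : (tri k : K7) = 4 * ((k : K7) * (k + 1)) := by
  have h := congrArg (Int.cast : ℤ → K7) (tri_spec k)
  push_cast at h
  have h8 : (8 : K7) = 1 := by decide
  linear_combination 4 * h - (tri k : K7) * h8

/-- Residues of the exponents of the cube of the Euler product. -/
def setJ (c : K7) : Finset K7 := {0, c, 3 * c}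

/-- Residues of the exponents of the two special theta series. -/
def setR (c : K7) : Finset K7 := {0, c, 5 * c}

theorem supp_cube (c : ℕ) (hc : 0 < c) : Supp (ff c ^ 3) (setJ c) := by
  have h : Supp (2 * ff c ^ 3) (setJ c) := by
    refine supp_hasSum (jacobi_sym c hc) fun k hk => ?_
    have hk2 := right_ne_zero_of_mul hk
    push_cast
    rw [tri_cast]
    have : ∀ c x : K7, 2 * x + 1 ≠ 0 → c * (4 * (x * (x + 1))) ∈ setJ c := by decide
    exact this _ _ hk2
  intro n hn
  have h2 := h n hn
  rw [show (2 : K7⟦X⟧) = C (2 : K7) by rw [map_ofNat], coeff_C_mul] at h2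
  exact (mul_eq_zero.1 h2).resolve_left (by decide)

theorem rr_supp (c : ℕ) (hc : 0 < c) :
    ∃ R : K7⟦X⟧, Supp R (setR c) ∧ R * ff (2 * c) ^ 2 = ff c ^ 5 := by
  obtain ⟨R, h1, h2⟩ := rr_exists c hc
  refine ⟨R, supp_hasSum h1 fun k hk => ?_, h2⟩
  push_cast
  rw [tri_cast, tri_cast]
  push_cast
  have : ∀ c x : K7, 6 * x + 1 ≠ 0 →
      2 * c * (4 * (x * (x + 1))) + c * (4 * ((x - 1) * (x - 1 + 1))) ∈ setR c := by decide
  exact this _ _ hk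

theorem ss_supp (c : ℕ) (hc : 0 < c) :
    ∃ R : K7⟦X⟧, Supp R (setR c) ∧ R * ff (2 * c) = 2 * ff (4 * c) ^ 2 * ff c ^ 2 := by
  obtain ⟨R, h1, h2⟩ := ss_exists c hc
  refine ⟨R, supp_hasSum h1 fun k hk => ?_, h2⟩
  push_cast
  rw [tri_cast, tri_cast]
  push_cast
  have : ∀ c x : K7, 6 * x + 2 ≠ 0 →
      5 * c * (4 * (x * (x + 1))) + c * (4 * ((x - 1) * (x - 1 + 1))) ∈ setR c := by decide
  exact this _ _ hk

theorem main1 (F : K7⟦X⟧) (n : ℕ) (hn : (n : K7) = 3) : coeff n (F ^ 7 * ff 2 ^ 6) = 0 := by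
  have h := (supp_pow_seven F).mul ((supp_cube 2 (by omega)).mul (supp_cube 2 (by omega)))
  rw [← pow_add] at h
  refine h n ?_
  rw [hn]
  decide

theorem main7 (F : K7⟦X⟧) (n : ℕ) (hn : (n : K7) = 6) : coeff n (F ^ 7 * ff 4 ^ 6) = 0 := by
  have h := (supp_pow_seven F).mul ((supp_cube 4 (by omega)).mul (supp_cube 4 (by omega)))
  rw [← pow_add] at h
  refine h n ?_
  rw [hn]
  decide

theorem main4 (F : K7⟦X⟧) (n : ℕ) (hn : (n : K7) = 1) :
    coeff n (F ^ 7 * (ff 2 ^ 3 * ff 4 ^ 3)) = 0 := by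
  have h := (supp_pow_seven F).mul ((supp_cube 2 (by omega)).mul (supp_cube 4 (by omega)))
  refine h n ?_
  rw [hn]
  decide

theorem main3 (F : K7⟦X⟧) (n : ℕ) (hn : (n : K7) = 4) :
    coeff n (F ^ 7 * (ff 2 ^ 4 * ff 4 ^ 2)) = 0 := by
  obtain ⟨R, hR, hR2⟩ := rr_supp 8 (by omega)
  obtain ⟨S, hS, hS2⟩ := ss_supp 4 (by omega)
  norm_num at hR2 hS2
  have d1 := pp_dissect 1 (by omega)
  have d2 := pn_dissect 1 (by omega)
  have m1 := pn_mul 1 (by omega)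
  have m2 := pp_mul 1 (by omega)
  have m3 := pp_mul 4 (by omega)
  have m4 := ps_mul 8 (by omega)
  norm_num at d1 d2 m1 m2 m3 m4
  have n1 := ff_ne_zero 1 (by omega)
  have n2 := ff_ne_zero 2 (by omega)
  have n8 := ff_ne_zero 8 (by omega)
  have n16 := ff_ne_zero 16 (by omega)
  have k1 : pp 4 * ff 4 ^ 2 = R := by
    refine mul_right_cancel₀ (pow_ne_zero 2 n16) ?_
    linear_combination m3 - hR2
  have k2 : ps 8 * ff 4 ^ 2 = S := by
    refine mul_right_cancel₀ n8 ?_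
    linear_combination ff 4 ^ 2 * m4 - hS2
  have k3 : pn 1 * pp 1 * ff 4 ^ 2 = ff 2 ^ 4 := by
    refine mul_right_cancel₀ (mul_ne_zero n2 (pow_ne_zero 2 n1)) ?_
    linear_combination (pp 1 * ff 4 ^ 2 * ff 1 ^ 2) * m1 + ff 1 ^ 2 * m2
  have k4 : ff 2 ^ 4 * ff 4 ^ 2 = R * R - X ^ 2 * (S * S) := by
    rw [← k3, ← k1, ← k2, d1, d2]
    ring
  rw [k4]
  have h := (supp_pow_seven F).mul ((hR.mul hR).sub ((supp_X_pow 2).mul (hS.mul hS)))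
  refine h n ?_
  rw [hn]
  decide

theorem main5 (F : K7⟦X⟧) (n : ℕ) (hn : (n : K7) = 5) :
    coeff n (F ^ 7 * (ff 2 ^ 2 * ff 4 ^ 4)) = 0 := by
  obtain ⟨R, hR, hR2⟩ := rr_supp 16 (by omega)
  obtain ⟨S, hS, hS2⟩ := ss_supp 8 (by omega)
  obtain ⟨T, hT, hT2⟩ := rr_supp 4 (by omega)
  norm_num at hR2 hS2 hT2
  have d2 := pn_dissect 2 (by omega)
  have m1 := pn_mul 2 (by omega)
  have m3 := pp_mul 8 (by omega)
  have m4 := ps_mul 16 (by omega)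
  norm_num at d2 m1 m3 m4
  have n4 := ff_ne_zero 4 (by omega)
  have n16 := ff_ne_zero 16 (by omega)
  have n32 := ff_ne_zero 32 (by omega)
  have k1 : pp 8 * ff 8 ^ 2 = R := by
    refine mul_right_cancel₀ (pow_ne_zero 2 n32) ?_
    linear_combination m3 - hR2
  have k2 : ps 16 * ff 8 ^ 2 = S := by
    refine mul_right_cancel₀ n16 ?_
    linear_combination ff 8 ^ 2 * m4 - hS2
  have k4 : ff 2 ^ 2 * ff 4 ^ 4 = (R - X ^ 2 * S) * T := by
    refine mul_right_cancel₀ n4 ?_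
    have : R - X ^ 2 * S = pn 2 * ff 8 ^ 2 := by
      rw [← k1, ← k2, d2]; ring
    rw [this]
    linear_combination (-ff 4 ^ 5) * m1 - pn 2 * ff 4 * hT2
  rw [k4]
  have h := (supp_pow_seven F).mul ((hR.sub ((supp_X_pow 2).mul hS)).mul hT)
  refine h n ?_
  rw [hn]
  decide

/-- Multisets with elements in `s` and total weight `n`. -/
def wtSet (w : ℕ × ℕ → ℕ) (s : Finset (ℕ × ℕ)) (n : ℕ) : Set (Multiset (ℕ × ℕ)) :=
  {m | (∀ p ∈ m, p ∈ s) ∧ (m.map w).sum = n}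

theorem wtSet_insert (w : ℕ × ℕ → ℕ) (s : Finset (ℕ × ℕ)) (p : ℕ × ℕ) (n : ℕ) :
    wtSet w (insert p s) n = wtSet w s n ∪
      (if w p ≤ n then (fun m => p ::ₘ m) '' wtSet w (insert p s) (n - w p) else ∅) := by
  ext m
  constructor
  · rintro ⟨h1, h2⟩
    by_cases hp : p ∈ m
    · right
      obtain ⟨m', rfl⟩ := Multiset.exists_cons_of_mem hp
      rw [Multiset.map_cons, Multiset.sum_cons] at h2
      rw [if_pos (by omega)]
      refine ⟨m', ⟨fun q hq => h1 q (Multiset.mem_cons_of_mem hq), by omega⟩, rfl⟩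
    · left
      refine ⟨fun q hq => ?_, h2⟩
      rcases Finset.mem_insert.1 (h1 q hq) with rfl | h
      · exact absurd hq hp
      · exact h
  · rintro (⟨h1, h2⟩ | h)
    · exact ⟨fun q hq => Finset.mem_insert_of_mem (h1 q hq), h2⟩
    · split_ifs at h with hw
      · obtain ⟨m', ⟨h1, h2⟩, rfl⟩ := h
        refine ⟨fun q hq => ?_, ?_⟩
        · rcases Multiset.mem_cons.1 hq with rfl | h
          · exact Finset.mem_insert_self _ _
          · exact h1 q h
        · dsimp only
          rw [Multiset.map_cons, Multiset.sum_cons]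
          omega
      · exact absurd h (Set.notMem_empty _)

theorem wtSet_finite (w : ℕ × ℕ → ℕ) (s : Finset (ℕ × ℕ)) (hw : ∀ p ∈ s, 0 < w p) (n : ℕ) :
    (wtSet w s n).Finite := by
  induction s using Finset.induction_on generalizing n with
  | empty =>
    refine (Set.finite_singleton 0).subset ?_
    rintro m ⟨h, -⟩
    exact Multiset.eq_zero_of_forall_notMem fun p hp => Finset.notMem_empty p (h p hp)
  | insert p s hp ih =>
    have ih' := ih fun q hq => hw q (Finset.mem_insert_of_mem hq)
    have hpos := hw p (Finset.mem_insert_self _ _)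
    induction n using Nat.strong_induction_on with
    | _ n ihn =>
      rw [wtSet_insert]
      refine (ih' n).union ?_
      split_ifs with h
      · exact (ihn _ (by omega)).image _
      · exact Set.finite_empty

/-- The generating function of `wtSet`. -/
noncomputable def wtGF (w : ℕ × ℕ → ℕ) (s : Finset (ℕ × ℕ)) : K7⟦X⟧ :=
  PowerSeries.mk fun n => ((wtSet w s n).ncard : K7)

theorem wtGF_insert (w : ℕ × ℕ → ℕ) (s : Finset (ℕ × ℕ)) (p : ℕ × ℕ) (hp : p ∉ s)
    (hw : ∀ q ∈ insert p s, 0 < w q) :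
    (1 - X ^ w p) * wtGF w (insert p s) = wtGF w s := by
  ext n
  rw [sub_mul, one_mul, map_sub, coeff_X_pow_mul']
  unfold wtGF
  simp only [coeff_mk]
  have hf := wtSet_finite w s (fun q hq => hw q (Finset.mem_insert_of_mem hq)) n
  have key := wtSet_insert w s p n
  split_ifs at key ⊢ with h
  · rw [key, Set.ncard_union_eq ?_ hf ((wtSet_finite w _ hw _).image _),
      Set.ncard_image_of_injective _ fun x y h => (Multiset.cons_inj_right p).1 h]
    · push_cast; ring
    · rw [Set.disjoint_left]
      rintro m ⟨h1, -⟩ ⟨m', -, rfl⟩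
      exact hp (h1 p (Multiset.mem_cons_self p m'))
  · rw [key, Set.union_empty, sub_zero]

theorem wtGF_prod (w : ℕ × ℕ → ℕ) (s : Finset (ℕ × ℕ)) (hw : ∀ p ∈ s, 0 < w p) :
    (∏ p ∈ s, (1 - X ^ w p)) * wtGF w s = 1 := by
  induction s using Finset.induction_on with
  | empty =>
    rw [Finset.prod_empty, one_mul]
    ext n
    unfold wtGF
    rw [coeff_mk, coeff_one]
    split_ifs with h
    · have : wtSet w ∅ n = {0} := by
        ext m
        constructor
        · rintro ⟨h, -⟩
          exact Multiset.eq_zero_of_forall_notMem fun p hp => Finset.notMem_empty p (h p hp)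
        · rintro rfl
          exact ⟨fun p hp => absurd hp (Multiset.notMem_zero p), by simp [h]⟩
      rw [this, Set.ncard_singleton, Nat.cast_one]
    · have : wtSet w ∅ n = ∅ := by
        ext m
        constructor
        · rintro ⟨h1, h2⟩
          have : m = 0 :=
            Multiset.eq_zero_of_forall_notMem fun p hp => Finset.notMem_empty p (h1 p hp)
          subst this
          simp at h2
          omega
        · intro h
          exact absurd h (Set.notMem_empty _)
      rw [this, Set.ncard_empty, Nat.cast_zero]
  | insert p s hp ih =>
    rw [Finset.prod_insert hp, mul_comm (1 - X ^ w p), mul_assoc, wtGF_insert w s p hp hw]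
    exact ih fun q hq => hw q (Finset.mem_insert_of_mem hq)

/-- The admissible coloured parts of size at most `2 M`. -/
def parts (k M : ℕ) : Finset (ℕ × ℕ) :=
  (Finset.Icc 1 (2 * M) ×ˢ Finset.Icc 1 k).filter fun p => Even p.1 → p.2 = 1

theorem parts_prod (k M : ℕ) (hk : 0 < k) :
    ∏ p ∈ parts k M, (1 - X ^ (2 * p.1) : K7⟦X⟧) = gpp (-1) 2 4 M ^ k * gpp (-1) 4 4 M := by
  unfold parts
  rw [Finset.prod_filter, Finset.prod_product]
  dsimp only
  induction M with
  | zero => simp [gpp]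
  | succ M ih =>
    rw [show 2 * (M + 1) = 2 * M + 1 + 1 by ring, Finset.prod_Icc_succ_top (by omega),
      Finset.prod_Icc_succ_top (by omega), ih]
    have ho : ¬ Even (2 * M + 1) := Nat.not_even_iff_odd.2 (odd_two_mul_add_one M)
    have he : Even (2 * M + 1 + 1) := ⟨M + 1, by ring⟩
    have h1 : ∏ y ∈ Finset.Icc 1 k, (if Even (2 * M + 1) → y = 1 then
        (1 - X ^ (2 * (2 * M + 1)) : K7⟦X⟧) else 1) = (1 - X ^ (2 * (2 * M + 1))) ^ k := by
      rw [Finset.prod_congr rfl fun y _ => if_pos fun h => absurd h ho, Finset.prod_const,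
        Nat.card_Icc, Nat.add_sub_cancel]
    have h2 : ∏ y ∈ Finset.Icc 1 k, (if Even (2 * M + 1 + 1) → y = 1 then
        (1 - X ^ (2 * (2 * M + 1 + 1)) : K7⟦X⟧) else 1) = 1 - X ^ (2 * (2 * M + 1 + 1)) := by
      rw [Finset.prod_eq_single_of_mem 1 (Finset.mem_Icc.2 ⟨le_rfl, hk⟩)]
      · rw [if_pos fun _ => rfl]
      · intro b _ hb
        rw [if_neg fun h => hb (h he)]
    rw [h1, h2]
    unfold gpp
    rw [Finset.prod_range_succ, Finset.prod_range_succ, mul_pow]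
    rw [show 2 * (2 * M + 1) = 2 + 4 * M by ring, show 2 * (2 * M + 1 + 1) = 4 + 4 * M by ring,
      map_neg, map_one]
    ring

/-- The generating function of `a k` in `X ^ 2`. -/
noncomputable def aGF (k : ℕ) : K7⟦X⟧ := PowerSeries.mk fun n =>
  (({m | (∀ p ∈ m, 0 < p.1 ∧ 1 ≤ p.2 ∧ p.2 ≤ k ∧ (Even p.1 → p.2 = 1)) ∧
    (m.map fun p => 2 * p.1).sum = n} : Set (Multiset (ℕ × ℕ))).ncard : K7)

theorem aGF_mul (k : ℕ) (hk : 0 < k) : gp (-1) 2 4 ^ k * ff 4 * aGF k = 1 := by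
  have hC : Tendsto (fun M => wtGF (fun p => 2 * p.1) (parts k M)) atTop (𝓝 (aGF k)) := by
    rw [tendsto_iff_ev]
    intro n
    filter_upwards [eventually_ge_atTop n] with M hM
    unfold wtGF aGF
    rw [coeff_mk, coeff_mk]
    congr 2
    ext m
    unfold wtSet parts
    simp only [Set.mem_ofPred_eq, Finset.mem_filter, Finset.mem_product, Finset.mem_Icc]
    refine and_congr_left fun hs => forall_congr' fun p => forall_congr' fun hp => ?_
    have hle : 2 * p.1 ≤ n := by
      rw [← hs]
      exact Multiset.le_sum_of_mem (Multiset.mem_map_of_mem (fun p : ℕ × ℕ => 2 * p.1) hp)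
    constructor
    · rintro ⟨⟨⟨h1, h2⟩, h3, h4⟩, h5⟩
      exact ⟨h1, h3, h4, h5⟩
    · rintro ⟨h1, h3, h4, h5⟩
      exact ⟨⟨⟨h1, by omega⟩, h3, h4⟩, h5⟩
  have hP := ((tendsto_gpp (-1) 2 4 (by omega)).pow k).mul (tendsto_gpp (-1) 4 4 (by omega))
  have h := hP.mul hC
  refine tendsto_nhds_unique h ?_
  refine tendsto_const_nhds.congr fun M => ?_
  rw [← parts_prod k M hk]
  refine (wtGF_prod (fun p => 2 * p.1) (parts k M) fun p hp => ?_).symm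
  unfold parts at hp
  simp only [Finset.mem_filter, Finset.mem_product, Finset.mem_Icc] at hp
  omega

theorem coeff_aGF (k n : ℕ) : coeff (2 * n) (aGF k) = (a k n : K7) := by
  unfold aGF a
  rw [coeff_mk, Nat.card_coe_set_eq]
  congr 2
  ext m
  unfold coloredOddPartitions
  simp only [Set.mem_ofPred_eq]
  rw [Multiset.sum_map_mul_left]
  refine and_congr_right fun _ => ?_
  change 2 * (m.map Prod.fst).sum = 2 * n ↔ _
  omega

theorem aGF_eq (j r : ℕ) (hr : 0 < r) (hr7 : r ≤ 7) : ∃ F : K7⟦X⟧,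
    aGF (7 * j + r) = F ^ 7 * (ff 2 ^ (7 - r) * ff 4 ^ (r - 1)) := by
  obtain ⟨g, hg⟩ := (isUnit_ff 2 (by omega)).exists_right_inv
  obtain ⟨t, rfl⟩ : ∃ t, r = t + 1 := ⟨r - 1, by omega⟩
  obtain ⟨v, hv⟩ : ∃ v, 7 = t + 1 + v := ⟨7 - (t + 1), by omega⟩
  have e1 : 7 - (t + 1) = v := by omega
  have e2 : t + 1 - 1 = t := by omega
  rw [e1, e2]
  refine ⟨ff 4 ^ j * g ^ (j + 1), ?_⟩
  have h1 := aGF_mul (7 * j + (t + 1)) (by omega)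
  have h2 := ff_split 2 (by omega)
  norm_num at h2
  have h3 : ff 2 ^ (7 * j + (t + 1)) * aGF (7 * j + (t + 1)) = ff 4 ^ (7 * j + t) := by
    rw [h2, mul_pow, show 7 * j + (t + 1) = (7 * j + t) + 1 by ring] 
    rw [show 7 * j + (t + 1) = (7 * j + t) + 1 by ring] at h1
    rw [pow_succ (ff 4)]
    linear_combination ff 4 ^ (7 * j + t) * h1
  have h4 : ff 2 ^ (7 * (j + 1)) * g ^ (7 * (j + 1)) = 1 := by rw [← mul_pow, hg, one_pow]
  have h5 : ff 2 ^ (7 * (j + 1)) = ff 2 ^ (7 * j + (t + 1)) * ff 2 ^ v := by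
    rw [← pow_add]; congr 1; omega
  have h6 : (ff 4 ^ j * g ^ (j + 1)) ^ 7 * (ff 2 ^ v * ff 4 ^ t) =
      ff 4 ^ (7 * j + t) * ff 2 ^ v * g ^ (7 * (j + 1)) := by ring
  rw [h6, ← h3]
  rw [h5] at h4
  linear_combination (-aGF (7 * j + (t + 1))) * h4

theorem a_modEq {k n : ℕ} (h : coeff (2 * n) (aGF k) = 0) : a k n ≡ 0 [MOD 7] := by
  rw [coeff_aGF] at h
  exact (Nat.modEq_zero_iff_dvd).2 ((ZMod.natCast_eq_zero_iff _ _).1 h)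

theorem idx (n t : ℕ) : ((2 * (7 * n + t) : ℕ) : K7) = 2 * t := by
  have h7 : (7 : K7) = 0 := by decide
  push_cast
  linear_combination 2 * (n : K7) * h7

theorem stmt8 (j n : ℕ) :
    a (7 * j + 1) (7 * n + 5) ≡ 0 [MOD 7] ∧
    a (7 * j + 3) (7 * n + 2) ≡ 0 [MOD 7] ∧
    a (7 * j + 4) (7 * n + 4) ≡ 0 [MOD 7] ∧
    a (7 * j + 5) (7 * n + 6) ≡ 0 [MOD 7] ∧
    a (7 * j + 7) (7 * n + 3) ≡ 0 [MOD 7] := by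
  refine ⟨a_modEq ?_, a_modEq ?_, a_modEq ?_, a_modEq ?_, a_modEq ?_⟩
  · obtain ⟨F, hF⟩ := aGF_eq j 1 (by omega) (by omega)
    rw [hF, Nat.sub_self, pow_zero, mul_one]
    exact main1 F _ (by rw [idx]; decide)
  · obtain ⟨F, hF⟩ := aGF_eq j 3 (by omega) (by omega)
    rw [hF]
    exact main3 F _ (by rw [idx]; decide)
  · obtain ⟨F, hF⟩ := aGF_eq j 4 (by omega) (by omega)
    rw [hF]
    exact main4 F _ (by rw [idx]; decide)
  · obtain ⟨F, hF⟩ := aGF_eq j 5 (by omega) (by omega)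
    rw [hF]
    exact main5 F _ (by rw [idx]; decide)
  · obtain ⟨F, hF⟩ := aGF_eq j 7 (by omega) (by omega)
    rw [hF, Nat.sub_self, pow_zero, one_mul]
    exact main7 F _ (by rw [idx]; decide)
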